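/- (CPPI in the pathwise framework) Let S : [0,∞) → (0,∞) be continuous with continuous quadratic variation [S] along grids (T_N), and let B_t = exp(∫_0^t r_s ds) with r locally integrable. Fix V_0 ≥ 0, α ∈ [0,1], m > 0 and define C_t := (1−α)V_0 (S_t/S_0)^m B_t^{1−m} exp(−(1/2)m(m−1)[log S]_t) and V_t := C_t + α V_0 B_t, ξ_t := m C_t / S_t, η_t := (V_t − ξ_t S_t)/B_t. Then (ξ, η) is a self-financing strategy with portfolio value V: V_t = V_0 + ∫_0^t ξ_s dS_s + ∫_0^t η_s dB_s for all t ≥ 0, where the first integral is a pathwise Itô integral along (T_N). In particular C_t ≥ 0, i.e., V_t ≥ α V_0 B_t for all t ≥ 0. -/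

import Mathlib

open Filter Topology Set MeasureTheory

/-- A refining sequence of time grids: each grid is a strictly increasing
sequence starting at 0 and tending to infinity; grids are nested and the
mesh tends to zero. -/
structure GridSeq where
  T : ℕ → ℕ → ℝ
  zero : ∀ N, T N 0 = 0
  mono : ∀ N, StrictMono (T N)
  unbounded : ∀ N, Filter.Tendsto (T N) Filter.atTop Filter.atTop
  nested : ∀ N, Set.range (T N) ⊆ Set.range (T (N + 1))
  mesh : ∀ ε > 0, ∃ N₀, ∀ N ≥ N₀, ∀ i, T N (i + 1) - T N i ≤ ε

/-- The grid sum `∑_{t_i, t_{i+1} ∈ τ, t_{i+1} ≤ t} f(t_i, t_{i+1})`. -/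
noncomputable def gridSum (τ : ℕ → ℝ) (f : ℝ → ℝ → ℝ) (t : ℝ) : ℝ :=
  ∑' i : ℕ, if τ (i + 1) ≤ t then f (τ i) (τ (i + 1)) else 0

/-- The grid sums of `f` along the grid sequence `G` converge to `L` at time `t`. -/
def ConvTo (G : GridSeq) (f : ℝ → ℝ → ℝ) (t L : ℝ) : Prop :=
  Filter.Tendsto (fun N => gridSum (G.T N) f t) Filter.atTop (nhds L)

/-- `X` has continuous quadratic variation `Q` along the grid sequence `G`. -/
def HasQV (G : GridSeq) (X Q : ℝ → ℝ) : Prop :=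
  ContinuousOn Q (Set.Ici 0) ∧ Q 0 = 0 ∧
    ∀ t, ConvTo G (fun u v => (X v - X u) ^ 2) t (Q t)

/-- `A` is locally of finite variation on `[0,∞)`. -/
def LocBV (A : ℝ → ℝ) : Prop := ∀ T > 0, BoundedVariationOn A (Set.Icc 0 T)

/-- `ξ` is an admissible integrand for `X`: locally `ξ_t = g(A_t, X_t)` with
`g ∈ C¹` and `A` continuous of finite variation. -/
def Admissible (X ξ : ℝ → ℝ) : Prop :=
  ∀ T > 0, ∃ (n : ℕ) (g : (Fin n → ℝ) → ℝ → ℝ) (A : ℝ → Fin n → ℝ),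
    ContDiff ℝ 1 (Function.uncurry g) ∧
    (∀ k, ContinuousOn (fun t => A t k) (Set.Icc 0 T) ∧
      BoundedVariationOn (fun t => A t k) (Set.Icc 0 T)) ∧
    ∀ t ∈ Set.Icc (0 : ℝ) T, ξ t = g (A t) (X t)

theorem exists_grid_index {τ : ℕ → ℝ} (h0 : τ 0 = 0) (hu : Tendsto τ atTop atTop) {t : ℝ}
    (ht : 0 ≤ t) : ∃ n, τ n ≤ t ∧ t < τ (n + 1) := by
  have hex : ∃ k, t < τ k := (hu.eventually_gt_atTop t).exists
  classical
  have hpos : Nat.find hex ≠ 0 := fun h => by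
    have := Nat.find_spec hex
    rw [h, h0] at this
    linarith
  obtain ⟨n, hn⟩ := Nat.exists_eq_succ_of_ne_zero hpos
  refine ⟨n, not_lt.1 (Nat.find_min hex (by omega)), ?_⟩
  have := Nat.find_spec hex
  rwa [hn] at this

theorem gridSum_eq_sum_ite {τ : ℕ → ℝ} (hm : StrictMono τ) {s t : ℝ} {n : ℕ}
    (hn : t < τ (n + 1)) (hs : s ≤ t) (f : ℝ → ℝ → ℝ) :
    gridSum τ f s = ∑ i ∈ Finset.range n, if τ (i + 1) ≤ s then f (τ i) (τ (i + 1)) else 0 := by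
  refine tsum_eq_sum fun i hi => if_neg fun h => hi ?_
  have := hm.lt_iff_lt.1 (lt_of_le_of_lt (h.trans hs) hn)
  exact Finset.mem_range.2 (by omega)

theorem gridSum_eq_sum {τ : ℕ → ℝ} (hm : StrictMono τ) {t : ℝ} {n : ℕ}
    (hn : τ n ≤ t) (hn' : t < τ (n + 1)) (f : ℝ → ℝ → ℝ) :
    gridSum τ f t = ∑ i ∈ Finset.range n, f (τ i) (τ (i + 1)) := by
  rw [gridSum_eq_sum_ite hm hn' le_rfl]
  refine Finset.sum_congr rfl fun i hi => if_pos (le_trans (hm.monotone ?_) hn)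
  exact Finset.mem_range.1 hi

namespace GridSeq

variable (G : GridSeq)

theorem nonneg (N i : ℕ) : 0 ≤ G.T N i := by
  rw [← G.zero N]
  exact (G.mono N).monotone (Nat.zero_le i)

/-- A finite-sum representation, with the same index set for all summands. -/
theorem exists_gridSum_eq (N : ℕ) {t : ℝ} (ht : 0 ≤ t) :
    ∃ n, G.T N n ≤ t ∧ t < G.T N (n + 1) ∧
      ∀ f, gridSum (G.T N) f t = ∑ i ∈ Finset.range n, f (G.T N i) (G.T N (i + 1)) := by
  obtain ⟨n, hn, hn'⟩ := exists_grid_index (G.zero N) (G.unbounded N) ht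
  exact ⟨n, hn, hn', gridSum_eq_sum (G.mono N) hn hn'⟩

theorem range_subset {M N : ℕ} (h : M ≤ N) : Set.range (G.T M) ⊆ Set.range (G.T N) :=
  monotone_nat_of_le_succ (f := fun N => Set.range (G.T N)) G.nested h

theorem gridSum_le_gridSum (N : ℕ) {t δ : ℝ} (ht : 0 ≤ t)
    (hδ : ∀ i, G.T N (i + 1) - G.T N i ≤ δ) {f g : ℝ → ℝ → ℝ}
    (h : ∀ u v, 0 ≤ u → u ≤ v → v ≤ t → v - u ≤ δ → f u v ≤ g u v) :
    gridSum (G.T N) f t ≤ gridSum (G.T N) g t := by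
  obtain ⟨n, hn, -, hs⟩ := G.exists_gridSum_eq N ht
  rw [hs, hs]
  refine Finset.sum_le_sum fun i hi => h _ _ (G.nonneg N i) ((G.mono N).monotone i.le_succ)
    (le_trans ((G.mono N).monotone ?_) hn) (hδ i)
  exact Finset.mem_range.1 hi

theorem abs_gridSum_le (N : ℕ) {t : ℝ} (ht : 0 ≤ t) (f : ℝ → ℝ → ℝ) :
    |gridSum (G.T N) f t| ≤ gridSum (G.T N) (fun u v => |f u v|) t := by
  obtain ⟨n, -, -, hs⟩ := G.exists_gridSum_eq N ht
  rw [hs, hs]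
  exact Finset.abs_sum_le_sum_abs _ _

theorem gridSum_add (N : ℕ) {t : ℝ} (ht : 0 ≤ t) (f g : ℝ → ℝ → ℝ) :
    gridSum (G.T N) (fun u v => f u v + g u v) t =
      gridSum (G.T N) f t + gridSum (G.T N) g t := by
  obtain ⟨n, -, -, hs⟩ := G.exists_gridSum_eq N ht
  rw [hs, hs, hs, Finset.sum_add_distrib]

theorem gridSum_mul_left (N : ℕ) {t : ℝ} (ht : 0 ≤ t) (c : ℝ) (f : ℝ → ℝ → ℝ) :
    gridSum (G.T N) (fun u v => c * f u v) t = c * gridSum (G.T N) f t := by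
  obtain ⟨n, -, -, hs⟩ := G.exists_gridSum_eq N ht
  rw [hs, hs, Finset.mul_sum]

theorem gridSum_congr (N : ℕ) {t : ℝ} (ht : 0 ≤ t) {f g : ℝ → ℝ → ℝ}
    (h : ∀ u v, 0 ≤ u → u ≤ v → v ≤ t → f u v = g u v) :
    gridSum (G.T N) f t = gridSum (G.T N) g t := by
  obtain ⟨n, hn, -, hs⟩ := G.exists_gridSum_eq N ht
  rw [hs, hs]
  refine Finset.sum_congr rfl fun i hi => h _ _ (G.nonneg N i) ((G.mono N).monotone i.le_succ)
    (le_trans ((G.mono N).monotone ?_) hn)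
  exact Finset.mem_range.1 hi

/-- The grid sum over the intervals starting after a grid point `s`. -/
theorem gridSum_indicator (N : ℕ) {s t : ℝ} (hs : s ∈ Set.range (G.T N)) (hst : s ≤ t)
    (h : ℝ → ℝ → ℝ) :
    gridSum (G.T N) (fun u v => if s ≤ u then h u v else 0) t =
      gridSum (G.T N) h t - gridSum (G.T N) h s := by
  obtain ⟨k, rfl⟩ := hs
  obtain ⟨n, -, hn⟩ := exists_grid_index (G.zero N) (G.unbounded N) ((G.nonneg N k).trans hst)
  rw [gridSum_eq_sum_ite (G.mono N) hn le_rfl, gridSum_eq_sum_ite (G.mono N) hn le_rfl,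
    gridSum_eq_sum_ite (G.mono N) hn hst, ← Finset.sum_sub_distrib]
  refine Finset.sum_congr rfl fun i _ => ?_
  by_cases hki : k ≤ i
  · have h1 : G.T N k ≤ G.T N i := (G.mono N).monotone hki
    have h2 : ¬ G.T N (i + 1) ≤ G.T N k := fun h =>
      absurd ((G.mono N).le_iff_le.1 h) (by omega)
    simp [h1, h2]
  · have h1 : ¬ G.T N k ≤ G.T N i := fun h => hki ((G.mono N).le_iff_le.1 h)
    have h2 : G.T N (i + 1) ≤ G.T N k := (G.mono N).monotone (by omega)
    simp [h1, h2, h2.trans hst]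

end GridSeq

namespace ConvTo

variable {G : GridSeq} {f g : ℝ → ℝ → ℝ} {t a b : ℝ}

theorem add (hf : ConvTo G f t a) (hg : ConvTo G g t b) (ht : 0 ≤ t) :
    ConvTo G (fun u v => f u v + g u v) t (a + b) := by
  unfold ConvTo
  simp only [G.gridSum_add _ ht]
  exact Tendsto.add hf hg

theorem const_mul (hf : ConvTo G f t a) (ht : 0 ≤ t) (c : ℝ) :
    ConvTo G (fun u v => c * f u v) t (c * a) := by
  unfold ConvTo
  simp only [G.gridSum_mul_left _ ht]
  exact Tendsto.const_mul c hf

theorem sub (hf : ConvTo G f t a) (hg : ConvTo G g t b) (ht : 0 ≤ t) :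
    ConvTo G (fun u v => f u v - g u v) t (a - b) := by
  simpa [sub_eq_add_neg] using hf.add (hg.const_mul ht (-1)) ht

theorem congr (hf : ConvTo G f t a) (ht : 0 ≤ t)
    (h : ∀ u v, 0 ≤ u → u ≤ v → v ≤ t → f u v = g u v) : ConvTo G g t a :=
  Tendsto.congr (fun N => G.gridSum_congr N ht h) hf

theorem sum {k : ℕ} {F : ℕ → ℝ → ℝ → ℝ} (ht : 0 ≤ t) (hF : ∀ j < k, ConvTo G (F j) t 0) :
    ConvTo G (fun u v => ∑ j ∈ Finset.range k, F j u v) t 0 := by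
  induction k with
  | zero => simp [ConvTo, gridSum]
  | succ k ih =>
    simp only [Finset.sum_range_succ]
    simpa using (ih fun j hj => hF j (by omega)).add (hF k (by omega)) ht

end ConvTo

theorem ContinuousOn.exists_modulus {f : ℝ → ℝ} (hf : ContinuousOn f (Set.Ici 0)) (t : ℝ)
    {ε : ℝ} (hε : 0 < ε) :
    ∃ δ > 0, ∀ u v, 0 ≤ u → u ≤ v → v ≤ t → v - u ≤ δ → |f v - f u| ≤ ε := by
  have huc := isCompact_Icc.uniformContinuousOn_of_continuous
    (hf.mono (Set.Icc_subset_Ici_self : Set.Icc 0 t ⊆ Set.Ici 0))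
  obtain ⟨δ, hδ, h⟩ := Metric.uniformContinuousOn_iff.1 huc ε hε
  refine ⟨δ / 2, half_pos hδ, fun u v hu huv hv hd => ?_⟩
  have := h v ⟨hu.trans huv, hv⟩ u ⟨hu, huv.trans hv⟩
    (by rw [Real.dist_eq, abs_of_nonneg (by linarith)]; linarith)
  rw [Real.dist_eq] at this
  exact this.le

theorem convTo_telescope (G : GridSeq) {F : ℝ → ℝ} (hF : ContinuousOn F (Set.Ici 0)) {t : ℝ}
    (ht : 0 ≤ t) : ConvTo G (fun u v => F v - F u) t (F t - F 0) := by
  refine Metric.tendsto_atTop.2 fun ε hε => ?_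
  obtain ⟨δ, hδ, h⟩ := hF.exists_modulus t (half_pos hε)
  obtain ⟨N₀, hN₀⟩ := G.mesh δ hδ
  refine ⟨N₀, fun N hN => ?_⟩
  obtain ⟨n, hn, hn', hs⟩ := G.exists_gridSum_eq N ht
  have hd : t - G.T N n ≤ δ := by linarith [hN₀ N hN n]
  have := h _ _ (G.nonneg N n) hn le_rfl hd
  rw [hs, Finset.sum_range_sub (fun i => F (G.T N i)), G.zero, Real.dist_eq,
    sub_sub_sub_cancel_right, abs_sub_comm]
  linarith

theorem ConvTo.eventually_le {G : GridSeq} {f : ℝ → ℝ → ℝ} {t a : ℝ} (h : ConvTo G f t a) :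
    ∀ᶠ N in atTop, gridSum (G.T N) f t ≤ a + 1 :=
  Filter.Tendsto.eventually_le_const (by linarith) h

/-- Grid sums of increments which are uniformly small compared with increments whose grid
sums converge tend to zero. -/
theorem convTo_zero_of_small {G : GridSeq} {h μ : ℝ → ℝ → ℝ} {t a : ℝ} (ht : 0 ≤ t)
    (hμ : ConvTo G μ t a)
    (hh : ∀ ε > 0, ∃ δ > 0, ∀ u v, 0 ≤ u → u ≤ v → v ≤ t → v - u ≤ δ →
      |h u v| ≤ ε * μ u v) : ConvTo G h t 0 := by
  refine squeeze_zero_norm' (a := fun N => |gridSum (G.T N) h t|) (by simp) ?_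
  refine Metric.tendsto_atTop.2 fun ε hε => ?_
  have hK : 0 < |a + 1| + 1 := by positivity
  obtain ⟨δ, hδ, hsmall⟩ := hh (ε / (|a + 1| + 1)) (by positivity)
  obtain ⟨N₀, hN₀⟩ := G.mesh δ hδ
  obtain ⟨N₁, hN₁⟩ := eventually_atTop.1 hμ.eventually_le
  refine ⟨max N₀ N₁, fun N hN => ?_⟩
  have h1 := G.gridSum_le_gridSum N ht (hN₀ N ((le_max_left _ _).trans hN)) hsmall
  rw [G.gridSum_mul_left N ht] at h1
  have h2 := hN₁ N ((le_max_right _ _).trans hN)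
  have h3 := G.abs_gridSum_le N ht h
  rw [Real.dist_eq, sub_zero, abs_abs]
  calc |gridSum (G.T N) h t| ≤ ε / (|a + 1| + 1) * gridSum (G.T N) μ t := h3.trans h1
    _ ≤ ε / (|a + 1| + 1) * |a + 1| := by
        gcongr
        exact h2.trans (le_abs_self _)
    _ < ε / (|a + 1| + 1) * (|a + 1| + 1) := by gcongr; linarith
    _ = ε := by field_simp

/-- Grid sums of increments with vanishing grid sums and bounded absolute grid sums stay
negligible after weighting with a continuous function. -/
theorem convTo_zero_weighted {G : GridSeq} {f : ℝ → ℝ} {h μ : ℝ → ℝ → ℝ} {t a : ℝ}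
    (ht : 0 ≤ t) (hf : ContinuousOn f (Set.Ici 0)) (hh : ∀ s, 0 ≤ s → ConvTo G h s 0)
    (hμ : ConvTo G μ t a)
    (hle : ∀ u v, 0 ≤ u → u ≤ v → v ≤ t → |h u v| ≤ μ u v) :
    ConvTo G (fun u v => f u * h u v) t 0 := by
  refine Metric.tendsto_atTop.2 fun ε hε => ?_
  obtain ⟨δ, hδ, hmod⟩ := hf.exists_modulus t (ε := ε / 2 / (|a + 1| + 1)) (by positivity)
  obtain ⟨M, hM⟩ := G.mesh δ hδ
  obtain ⟨n, hn, hn', -⟩ := G.exists_gridSum_eq M ht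
  set step : ℝ → ℝ := fun u => f 0 + gridSum (G.T M) (fun u v => f v - f u) u with hstep
  have hstep_near : ∀ u, 0 ≤ u → u ≤ t → |f u - step u| ≤ ε / 2 / (|a + 1| + 1) := by
    intro u hu hut
    obtain ⟨k, hk, hk', hs⟩ := G.exists_gridSum_eq M hu
    have := hmod _ _ (G.nonneg M k) hk hut (by linarith [hM M le_rfl k])
    simp only [hstep]
    rw [hs, Finset.sum_range_sub (fun i => f (G.T M i)), G.zero]
    simpa using this
  have hstep_conv : ConvTo G (fun u v => step u * h u v) t 0 := by
    have h1 : ∀ j < n, ConvTo G (fun u v => (f (G.T M (j + 1)) - f (G.T M j)) *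
        (if G.T M (j + 1) ≤ u then h u v else 0)) t 0 := by
      intro j hj
      have hjt : G.T M (j + 1) ≤ t := ((G.mono M).monotone hj).trans hn
      have h2 : ConvTo G (fun u v => if G.T M (j + 1) ≤ u then h u v else 0) t 0 := by
        have h3 := Tendsto.sub (hh t ht) (hh _ (G.nonneg M (j + 1)))
        rw [sub_zero] at h3
        refine Tendsto.congr' ?_ h3
        filter_upwards [eventually_ge_atTop M] with N hN
        exact (G.gridSum_indicator N (G.range_subset hN ⟨j + 1, rfl⟩) hjt h).symm
      simpa using h2.const_mul ht (f (G.T M (j + 1)) - f (G.T M j))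
    have h4 := ((hh t ht).const_mul ht (f 0)).add (ConvTo.sum ht h1) ht
    rw [mul_zero, add_zero] at h4
    refine h4.congr ht fun u v hu huv hv => ?_
    simp only [hstep]
    rw [gridSum_eq_sum_ite (G.mono M) hn' (huv.trans hv), add_mul, Finset.sum_mul]
    congr 1
    refine Finset.sum_congr rfl fun j _ => ?_
    split_ifs <;> simp
  obtain ⟨N₁, hN₁⟩ := eventually_atTop.1 hμ.eventually_le
  obtain ⟨N₂, hN₂⟩ := Metric.tendsto_atTop.1 hstep_conv (ε / 2) (half_pos hε)
  refine ⟨max N₁ N₂, fun N hN => ?_⟩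
  have h2 := hN₂ N ((le_max_right _ _).trans hN)
  have h3 : gridSum (G.T N) (fun u v => f u * h u v) t =
      gridSum (G.T N) (fun u v => (f u - step u) * h u v) t +
        gridSum (G.T N) (fun u v => step u * h u v) t := by
    rw [← G.gridSum_add N ht]
    exact G.gridSum_congr N ht fun u v _ _ _ => by ring
  have h4 : gridSum (G.T N) (fun u v => |(f u - step u) * h u v|) t ≤
      ε / 2 / (|a + 1| + 1) * gridSum (G.T N) μ t := by
    rw [← G.gridSum_mul_left N ht]
    obtain ⟨k, hk, -, hs⟩ := G.exists_gridSum_eq N ht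
    rw [hs, hs]
    refine Finset.sum_le_sum fun i hi => ?_
    have hi1 : G.T N (i + 1) ≤ t :=
      ((G.mono N).monotone (Finset.mem_range.1 hi : i + 1 ≤ k)).trans hk
    have hi2 : G.T N i ≤ G.T N (i + 1) := (G.mono N).monotone i.le_succ
    rw [abs_mul]
    exact mul_le_mul (hstep_near _ (G.nonneg N i) (hi2.trans hi1))
      (hle _ _ (G.nonneg N i) hi2 hi1) (abs_nonneg _) (by positivity)
  have h5 := hN₁ N ((le_max_left _ _).trans hN)
  have h6 := G.abs_gridSum_le N ht (fun u v => (f u - step u) * h u v)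
  have h7 : ε / 2 / (|a + 1| + 1) * gridSum (G.T N) μ t ≤ ε / 2 := by
    calc _ ≤ ε / 2 / (|a + 1| + 1) * (|a + 1| + 1) := by
          gcongr
          linarith [le_abs_self (a + 1)]
      _ = ε / 2 := by field_simp
  rw [Real.dist_eq, sub_zero] at h2 ⊢
  rw [h3]
  refine (abs_add_le _ _).trans_lt ?_
  linarith

theorem HasQV.monotoneOn {G : GridSeq} {X Q : ℝ → ℝ} (h : HasQV G X Q) :
    MonotoneOn Q (Set.Ici 0) := by
  intro s hs t _ hst
  refine le_of_tendsto_of_tendsto' (h.2.2 s) (h.2.2 t) fun N => ?_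
  obtain ⟨n, -, hn⟩ := exists_grid_index (G.zero N) (G.unbounded N) (le_trans hs hst)
  rw [gridSum_eq_sum_ite (G.mono N) hn hst, gridSum_eq_sum_ite (G.mono N) hn le_rfl]
  refine Finset.sum_le_sum fun i _ => ?_
  split_ifs with h1 h2 h2
  · exact le_rfl
  · exact absurd (h1.trans hst) h2
  · positivity
  · exact le_rfl

theorem HasQV.convTo_weighted {G : GridSeq} {X Q f : ℝ → ℝ} (h : HasQV G X Q)
    (hf : ContinuousOn f (Set.Ici 0)) {t : ℝ} (ht : 0 ≤ t) :
    ConvTo G (fun u v => f u * ((X v - X u) ^ 2 - (Q v - Q u))) t 0 := by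
  refine convTo_zero_weighted ht hf (fun s hs => ?_)
    ((h.2.2 t).add (convTo_telescope G h.1 ht) ht) fun u v hu huv _ => ?_
  · simpa [h.2.1] using (h.2.2 s).sub (convTo_telescope G h.1 hs) hs
  · have h1 : Q u ≤ Q v := h.monotoneOn hu (hu.trans huv : (0 : ℝ) ≤ v) huv
    rw [abs_le]
    constructor <;> nlinarith [sq_nonneg (X v - X u)]

/-- Second-order expansion behind the Itô formula for exponentials. -/
theorem exp_expansion_small {m : ℝ} (hm : 0 ≤ m) {ε : ℝ} (hε : 0 < ε) :
    ∃ δ > 0, ∀ x y : ℝ, |x| ≤ δ → |y| ≤ δ →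
      |Real.exp (m * x + y) - 1 - m * (Real.exp x - 1) - m * (m - 1) / 2 * x ^ 2 - y| ≤
        ε * (x ^ 2 + |y|) := by
  have key : ∀ z : ℝ, |z| ≤ 1 → |Real.exp z - 1 - z - z ^ 2 / 2| ≤ |z| ^ 3 := by
    intro z hz
    have h := Real.exp_bound hz (n := 3) (by norm_num)
    norm_num [Finset.sum_range_succ, Nat.factorial] at h
    have h3 : (0 : ℝ) ≤ |z| ^ 3 := by positivity
    have e : Real.exp z - 1 - z - z ^ 2 / 2 = Real.exp z - (1 + z + z ^ 2 / 2) := by ring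
    rw [e]
    linarith
  set K := 4 * m ^ 3 + 2 * m + 5 with hK
  have hKpos : 0 < K := by positivity
  refine ⟨min (1 / (m + 1)) (ε / K), by positivity, fun x y hx hy => ?_⟩
  set δ := min (1 / (m + 1)) (ε / K)
  have hδ0 : 0 ≤ δ := (abs_nonneg x).trans hx
  have hδ1 : δ * (m + 1) ≤ 1 := by
    have := min_le_left (1 / (m + 1)) (ε / K)
    rwa [le_div_iff₀ (by positivity)] at this
  have hδK : δ * K ≤ ε := by
    have := min_le_right (1 / (m + 1)) (ε / K)
    rwa [le_div_iff₀ hKpos] at this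
  have hδ1' : δ ≤ 1 := by nlinarith
  have hz : |m * x + y| ≤ m * |x| + |y| := by
    refine (abs_add_le _ _).trans ?_
    rw [abs_mul, abs_of_nonneg hm]
  have hz1 : |m * x + y| ≤ 1 := by nlinarith
  have k1 := key _ hz1
  have k2 := key x (hx.trans hδ1')
  have hx2 : x ^ 2 = |x| ^ 2 := (sq_abs x).symm
  have e : Real.exp (m * x + y) - 1 - m * (Real.exp x - 1) - m * (m - 1) / 2 * x ^ 2 - y =
      (Real.exp (m * x + y) - 1 - (m * x + y) - (m * x + y) ^ 2 / 2)
        - m * (Real.exp x - 1 - x - x ^ 2 / 2) + (m * (x * y) + y ^ 2 / 2) := by ring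
  have b1 : |m * x + y| ^ 3 ≤ 4 * m ^ 3 * δ * |x| ^ 2 + 4 * δ * |y| := by
    have ha : 0 ≤ m * |x| := by positivity
    have hb := abs_nonneg y
    have c1 : |m * x + y| ^ 3 ≤ (m * |x| + |y|) ^ 3 := by gcongr
    have c2 : (m * |x| + |y|) ^ 3 ≤ 4 * ((m * |x|) ^ 3 + |y| ^ 3) := by
      nlinarith [mul_nonneg (add_nonneg ha hb) (sq_nonneg (m * |x| - |y|))]
    have c3 : |x| ^ 3 ≤ δ * |x| ^ 2 := by nlinarith [sq_nonneg |x|]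
    have c4 : |y| ^ 3 ≤ δ * |y| := by nlinarith [mul_nonneg hb hb, mul_nonneg hδ0 hb]
    have c5 : m ^ 3 * |x| ^ 3 ≤ m ^ 3 * (δ * |x| ^ 2) := by gcongr
    nlinarith
  have b2 : m * |x| ^ 3 ≤ m * (δ * |x| ^ 2) := by
    gcongr
    nlinarith [sq_nonneg |x|]
  have b3 : |m * (x * y) + y ^ 2 / 2| ≤ m * (δ * |y|) + δ * |y| := by
    refine (abs_add_le _ _).trans ?_
    rw [abs_mul, abs_mul, abs_of_nonneg hm, abs_of_nonneg (by positivity : 0 ≤ y ^ 2 / 2),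
      ← sq_abs y]
    gcongr
    nlinarith [abs_nonneg y]
  have b4 : |m * (Real.exp x - 1 - x - x ^ 2 / 2)| ≤ m * |x| ^ 3 := by
    rw [abs_mul, abs_of_nonneg hm]
    gcongr
  rw [e]
  calc _ ≤ |m * x + y| ^ 3 + m * |x| ^ 3 + (m * (δ * |y|) + δ * |y|) := by
        refine (abs_add_le _ _).trans (add_le_add ((abs_sub _ _).trans (add_le_add k1 b4)) b3)
    _ ≤ (δ * K) * (|x| ^ 2 + |y|) := by
        have d1 : 0 ≤ δ * |x| ^ 2 := by positivity
        have d2 : 0 ≤ δ * |y| := by positivity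
        have d3 := mul_nonneg hm d1
        have d4 := mul_nonneg hm d2
        have d5 := mul_nonneg (pow_nonneg hm 3) d2
        rw [hK]
        nlinarith
    _ ≤ ε * (x ^ 2 + |y|) := by
        rw [hx2]
        gcongr

theorem intervalIntegrable_of_nonneg {r : ℝ → ℝ} (hr : ∀ t > 0, IntervalIntegrable r volume 0 t)
    {u v : ℝ} (hu : 0 ≤ u) (hv : 0 ≤ v) :
    IntervalIntegrable r volume u v := by
  have h : ∀ s, 0 ≤ s → IntervalIntegrable r volume 0 s := fun s hs => by
    rcases hs.eq_or_lt with rfl | h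
    · exact IntervalIntegrable.refl
    · exact hr s h
  exact (h u hu).symm.trans (h v hv)

theorem continuousOn_primitive_Ici {r : ℝ → ℝ} (hr : ∀ t > 0, IntervalIntegrable r volume 0 t) :
    ContinuousOn (fun t => ∫ s in (0 : ℝ)..t, r s) (Set.Ici 0) := by
  intro x hx
  have hx' : (0 : ℝ) ≤ x := hx
  have hc := intervalIntegral.continuousOn_primitive_interval'
    (intervalIntegrable_of_nonneg hr le_rfl (by linarith : 0 ≤ x + 1)) left_mem_uIcc
  rw [uIcc_of_le (by linarith)] at hc
  refine (hc x ⟨hx', by linarith⟩).mono_of_mem_nhdsWithin ?_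
  rw [← Set.Ici_inter_Iic]
  exact inter_mem self_mem_nhdsWithin (mem_nhdsWithin_of_mem_nhds (Iic_mem_nhds (by linarith)))

theorem primitive_sub {r : ℝ → ℝ} (hr : ∀ t > 0, IntervalIntegrable r volume 0 t)
    {u v : ℝ} (hu : 0 ≤ u) (hv : 0 ≤ v) :
    (∫ s in (0 : ℝ)..v, r s) - ∫ s in (0 : ℝ)..u, r s = ∫ s in u..v, r s :=
  intervalIntegral.integral_interval_sub_left (intervalIntegrable_of_nonneg hr le_rfl hv)
    (intervalIntegrable_of_nonneg hr le_rfl hu)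

/-- Error of a left-point Riemann sum on a single interval. -/
theorem abs_riemann_error_le {r : ℝ → ℝ} (hr : ∀ t > 0, IntervalIntegrable r volume 0 t)
    {f : ℝ → ℝ} (hf : ContinuousOn f (Set.Ici 0)) {u v ε : ℝ} (hu : 0 ≤ u) (huv : u ≤ v)
    (hε : ∀ s, u ≤ s → s ≤ v → |f s - f u| ≤ ε) :
    |f u * (∫ s in u..v, r s) - ∫ s in u..v, f s * r s| ≤ ε * ∫ s in u..v, |r s| := by
  have hi := intervalIntegrable_of_nonneg hr hu (hu.trans huv)
  have hfi : IntervalIntegrable (fun s => f s * r s) volume u v := hi.continuousOn_mul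
    (hf.mono (by rw [uIcc_of_le huv]; exact fun s hs => hu.trans hs.1))
  rw [← intervalIntegral.integral_const_mul, ← intervalIntegral.integral_sub (hi.const_mul _) hfi,
    ← intervalIntegral.integral_const_mul, ← Real.norm_eq_abs]
  refine intervalIntegral.norm_integral_le_of_norm_le huv (ae_of_all _ fun s hs => ?_)
    (hi.abs.const_mul _)
  rw [← sub_mul, norm_mul, Real.norm_eq_abs, Real.norm_eq_abs, abs_sub_comm]
  gcongr
  exact hε s hs.1.le hs.2

theorem abs_weighted_add_le {a b k d K L ε w μ ρ : ℝ} (hK : 0 ≤ K) (hL : 0 < L) (hε : 0 < ε)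
    (ha : |a| ≤ K) (hb : |b| ≤ ε / (2 * (K + 1) * L) * w) (hw : w ≤ L * μ)
    (hd : |d| ≤ ε / (2 * (|k| + 1)) * ρ) (hρ : ρ ≤ μ) : |a * b + k * d| ≤ ε * μ := by
  have p1 : |a| * |b| ≤ ε / 2 * μ := by
    calc _ ≤ (K + 1) * (ε / (2 * (K + 1) * L) * (L * μ)) := by
          refine mul_le_mul (by linarith) (hb.trans ?_) (abs_nonneg _) (by positivity)
          gcongr
      _ = ε / 2 * μ := by field_simp
  have p2 : |k| * |d| ≤ ε / 2 * μ := by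
    calc _ ≤ (|k| + 1) * (ε / (2 * (|k| + 1)) * μ) := by
          refine mul_le_mul (by linarith) (hd.trans ?_) (abs_nonneg _) (by positivity)
          gcongr
      _ = ε / 2 * μ := by field_simp
  refine (abs_add_le _ _).trans ?_
  rw [abs_mul, abs_mul]
  linarith

/-- Pathwise Itô formula for the exponential of `m X + (1 - m) ∫ r - m (m - 1) Q / 2`. -/
theorem convTo_ito_exp {r : ℝ → ℝ} (hr : ∀ t > 0, IntervalIntegrable r volume 0 t)
    {G : GridSeq} {X Q C : ℝ → ℝ} (hX : ContinuousOn X (Set.Ici 0))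
    (hQ : HasQV G X Q) {m c : ℝ} (hm : 0 ≤ m)
    (hC : ∀ t, 0 ≤ t → C t = c * Real.exp (m * X t + (1 - m) * (∫ s in (0 : ℝ)..t, r s)
      - m * (m - 1) / 2 * Q t)) {t : ℝ} (ht : 0 ≤ t) :
    ConvTo G (fun u v => m * C u * (Real.exp (X v - X u) - 1)) t
      (C t - C 0 - (1 - m) * ∫ s in (0 : ℝ)..t, C s * r s) := by
  have hR := continuousOn_primitive_Ici hr
  have habs : ∀ t > 0, IntervalIntegrable (fun s => |r s|) volume 0 t := fun t ht => (hr t ht).abs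
  have hCc : ContinuousOn C (Set.Ici 0) := by
    have hQc := hQ.1
    refine ContinuousOn.congr (f := fun t => c * Real.exp (m * X t +
      (1 - m) * (∫ s in (0 : ℝ)..t, r s) - m * (m - 1) / 2 * Q t)) ?_ fun s hs => hC s hs
    fun_prop
  have hCr : ∀ t > 0, IntervalIntegrable (fun s => C s * r s) volume 0 t := fun t ht =>
    (hr t ht).continuousOn_mul (hCc.mono (by rw [uIcc_of_le ht.le]; exact Icc_subset_Ici_self))
  have hCrc := continuousOn_primitive_Ici hCr
  set R : ℝ → ℝ := fun t => ∫ s in (0 : ℝ)..t, r s with hRdef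
  set Y : ℝ → ℝ := fun t => (1 - m) * R t - m * (m - 1) / 2 * Q t with hY
  have hYc : ContinuousOn Y (Set.Ici 0) := by
    have hQc := hQ.1
    fun_prop
  set F : ℝ → ℝ := fun t => C t - (1 - m) * ∫ s in (0 : ℝ)..t, C s * r s with hF
  have hFc : ContinuousOn F (Set.Ici 0) := by fun_prop
  obtain ⟨K, hK⟩ : ∃ K, ∀ s ∈ Set.Icc 0 t, |C s| ≤ K := by
    obtain ⟨K, hK⟩ := isCompact_Icc.exists_bound_of_continuousOn
      (hCc.mono (Icc_subset_Ici_self : Set.Icc 0 t ⊆ _))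
    exact ⟨K, hK⟩
  have hK0 : 0 ≤ K := (abs_nonneg _).trans (hK 0 ⟨le_rfl, ht⟩)
  have hμ := ((hQ.2.2 t).add (convTo_telescope G hQ.1 ht) ht).add
    (convTo_telescope G (continuousOn_primitive_Ici habs) ht) ht
  have hsmall : ConvTo G (fun u v => (F v - F u) - m * C u * (Real.exp (X v - X u) - 1) -
      m * (m - 1) / 2 * (C u * ((X v - X u) ^ 2 - (Q v - Q u)))) t 0 := by
    refine convTo_zero_of_small ht hμ fun ε hε => ?_
    set L := 1 + |1 - m| + |m * (m - 1) / 2| with hL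
    have hLpos : 0 < L := by positivity
    obtain ⟨δ₀, hδ₀, hexp⟩ := exp_expansion_small hm
      (ε := ε / (2 * (K + 1) * L)) (by positivity)
    obtain ⟨δ₁, hδ₁, hX1⟩ := hX.exists_modulus t hδ₀
    obtain ⟨δ₂, hδ₂, hY1⟩ := hYc.exists_modulus t hδ₀
    obtain ⟨δ₃, hδ₃, hC1⟩ := hCc.exists_modulus t (ε := ε / (2 * (|1 - m| + 1))) (by positivity)
    refine ⟨min δ₁ (min δ₂ δ₃), by positivity, fun u v hu huv hv hd => ?_⟩
    have hv0 := hu.trans huv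
    have hx := hX1 u v hu huv hv (hd.trans (min_le_left _ _))
    have hy := hY1 u v hu huv hv (hd.trans ((min_le_right _ _).trans (min_le_left _ _)))
    have hd3 : v - u ≤ δ₃ := hd.trans ((min_le_right _ _).trans (min_le_right _ _))
    have he := hexp _ _ hx hy
    rw [primitive_sub habs hu hv0]
    set x := X v - X u
    set y := Y v - Y u with hy_def
    set ρ := ∫ s in u..v, |r s|
    have hρ0 : 0 ≤ ρ := intervalIntegral.integral_nonneg huv fun s _ => abs_nonneg _
    have hQ0 : 0 ≤ Q v - Q u := sub_nonneg.2 (hQ.monotoneOn hu hv0 huv)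
    have hRρ : |R v - R u| ≤ ρ := by
      simp only [hRdef]
      rw [primitive_sub hr hu hv0]
      exact intervalIntegral.abs_integral_le_integral_abs huv
    have hCv : C v = C u * Real.exp (m * x + y) := by
      rw [hC v hv0, hC u hu, mul_assoc, ← Real.exp_add]
      congr 2
      simp only [x, hy_def, hY, hRdef]
      ring
    have hriem : |C u * (R v - R u) - ∫ s in u..v, C s * r s| ≤ ε / (2 * (|1 - m| + 1)) * ρ := by
      simp only [hRdef]
      rw [primitive_sub hr hu hv0]
      exact abs_riemann_error_le hr hCc hu huv fun s hs hs' =>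
        hC1 u s hu hs (hs'.trans hv) (by linarith)
    have hyb : x ^ 2 + |y| ≤ L * (x ^ 2 + (Q v - Q u) + ρ) := by
      have e : y = (1 - m) * (R v - R u) - m * (m - 1) / 2 * (Q v - Q u) := by
        simp only [hy_def, hY]; ring
      have h1 : |y| ≤ |1 - m| * ρ + |m * (m - 1) / 2| * (Q v - Q u) := by
        rw [e]
        refine (abs_sub _ _).trans ?_
        rw [abs_mul, abs_mul, abs_of_nonneg hQ0]
        gcongr
      have a1 := abs_nonneg (1 - m)
      have a2 := abs_nonneg (m * (m - 1) / 2)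
      have := sq_nonneg x
      rw [hL]
      nlinarith [mul_nonneg a1 hQ0, mul_nonneg a2 hρ0, mul_nonneg a1 this, mul_nonneg a2 this]
    have hcr : (∫ s in (0 : ℝ)..v, C s * r s) - (∫ s in (0 : ℝ)..u, C s * r s) =
        ∫ s in u..v, C s * r s := primitive_sub hCr hu hv0
    have e : (F v - F u) - m * C u * (Real.exp x - 1) -
        m * (m - 1) / 2 * (C u * (x ^ 2 - (Q v - Q u))) =
        C u * (Real.exp (m * x + y) - 1 - m * (Real.exp x - 1) - m * (m - 1) / 2 * x ^ 2 - y) +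
          (1 - m) * (C u * (R v - R u) - ∫ s in u..v, C s * r s) := by
      rw [← hcr]
      simp only [hF, hCv, hy_def, hY]
      ring
    rw [e]
    exact abs_weighted_add_le hK0 hLpos hε (hK u ⟨hu, huv.trans hv⟩) he hyb hriem
      (by nlinarith [sq_nonneg x])
  have hw := (hQ.convTo_weighted hCc ht).const_mul ht (m * (m - 1) / 2)
  have hfin := ((convTo_telescope G hFc ht).sub hsmall ht).sub hw ht
  have hval : F t - F 0 - 0 - m * (m - 1) / 2 * 0 =
      C t - C 0 - (1 - m) * ∫ s in (0 : ℝ)..t, C s * r s := by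
    simp only [hF, intervalIntegral.integral_same]
    ring
  rw [hval] at hfin
  exact hfin.congr ht fun u v _ _ _ => by ring

/-- A positive continuously differentiable function agreeing with the identity above `δ`. -/
theorem exists_contDiff_pos_eq_self {δ : ℝ} (hδ : 0 < δ) :
    ∃ ψ : ℝ → ℝ, ContDiff ℝ 1 ψ ∧ (∀ x, 0 < ψ x) ∧ ∀ x, δ ≤ x → ψ x = x := by
  refine ⟨fun x => Real.smoothTransition (x / δ) * x + (1 - Real.smoothTransition (x / δ)),
    ?_, fun x => ?_, fun x hx => ?_⟩
  · have h : ContDiff ℝ 1 fun x : ℝ => Real.smoothTransition (x / δ) :=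
      Real.smoothTransition.contDiff.comp (contDiff_id.div_const δ)
    fun_prop
  · rcases le_or_gt x 0 with hx | hx
    · simp [Real.smoothTransition.zero_of_nonpos (div_nonpos_of_nonpos_of_nonneg hx hδ.le)]
    · have h1 := Real.smoothTransition.pos_of_pos (div_pos hx hδ)
      have h2 := Real.smoothTransition.le_one (x / δ)
      have h3 := mul_pos h1 hx
      simp only
      linarith
  · simp [Real.smoothTransition.one_of_one_le ((one_le_div hδ).2 hx)]

/-- CPPI in the pathwise framework: the explicit cushion yields
a self-financing strategy whose value never breaks through the floor. -/
theorem stmt12 (G : GridSeq) (S QS QL r B : ℝ → ℝ)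
    (hS : ContinuousOn S (Set.Ici 0)) (hSpos : ∀ t ∈ Set.Ici (0 : ℝ), 0 < S t)
    (hQS : HasQV G S QS)
    (hQL : HasQV G (fun t => Real.log (S t)) QL)
    (hr : ∀ t > 0, IntervalIntegrable r MeasureTheory.volume 0 t)
    (hB : ∀ t, B t = Real.exp (∫ s in (0 : ℝ)..t, r s))
    (V₀ α m : ℝ) (hV₀ : 0 ≤ V₀) (hα : α ∈ Set.Icc (0 : ℝ) 1) (hm : 0 < m)
    (C V ξ η : ℝ → ℝ)
    (hC : ∀ t, C t = (1 - α) * V₀ * (S t / S 0) ^ m * (B t) ^ (1 - m) *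
      Real.exp (-(1 / 2) * m * (m - 1) * QL t))
    (hV : ∀ t, V t = C t + α * V₀ * B t)
    (hξ : ∀ t, ξ t = m * C t / S t)
    (hη : ∀ t, η t = (V t - ξ t * S t) / B t) :
    Admissible S ξ ∧
    (∀ t ≥ 0, V t = ξ t * S t + η t * B t) ∧
    (∀ t ≥ 0, ∃ I, ConvTo G (fun u v => ξ u * (S v - S u)) t I ∧
      V t = V₀ + I + ∫ s in (0 : ℝ)..t, η s * r s * B s) ∧
    ∀ t ≥ 0, α * V₀ * B t ≤ V t := by
  have hS0 : 0 < S 0 := hSpos 0 (Set.mem_Ici.2 le_rfl)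
  have hBpos : ∀ t, 0 < B t := fun t => by rw [hB]; exact Real.exp_pos _
  have hX : ContinuousOn (fun t => Real.log (S t)) (Set.Ici 0) :=
    hS.log fun t ht => (hSpos t ht).ne'
  have hCexp : ∀ t, 0 ≤ t → C t = ((1 - α) * V₀ * Real.exp (-m * Real.log (S 0))) *
      Real.exp (m * Real.log (S t) + (1 - m) * (∫ s in (0 : ℝ)..t, r s)
        - m * (m - 1) / 2 * QL t) := by
    intro t ht
    have hSt : 0 < S t := hSpos t ht
    rw [hC, Real.rpow_def_of_pos (div_pos hSt hS0), Real.rpow_def_of_pos (hBpos t), hB,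
      Real.log_exp, Real.log_div hSt.ne' hS0.ne']
    simp only [mul_assoc, ← Real.exp_add]
    congr 3
    ring
  have hC0 : ∀ t, 0 ≤ t → 0 ≤ C t := fun t ht => by
    rw [hCexp t ht]
    have : 0 ≤ 1 - α := sub_nonneg.2 hα.2
    positivity
  have hR := continuousOn_primitive_Ici hr
  refine ⟨?_, ?_, ?_, fun t ht => by rw [hV]; linarith [hC0 t ht]⟩
  · intro T hT
    have hST : ContinuousOn S (Set.Icc 0 T) := hS.mono Icc_subset_Ici_self
    obtain ⟨s₀, hs₀, hmin⟩ := isCompact_Icc.exists_isMinOn (nonempty_Icc.2 hT.le) hST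
    obtain ⟨ψ, hψ, hψpos, hψid⟩ := exists_contDiff_pos_eq_self (hSpos s₀ hs₀.1)
    refine ⟨2, fun a x => m * ((1 - α) * V₀ * Real.exp (-m * Real.log (S 0))) *
      Real.exp ((m - 1) * Real.log (ψ x) + (1 - m) * a 0 - m * (m - 1) / 2 * a 1),
      fun t => ![∫ s in (0 : ℝ)..t, r s, QL t], ?_, ?_, ?_⟩
    · have hlog : ContDiff ℝ 1 fun p : (Fin 2 → ℝ) × ℝ => Real.log (ψ p.2) :=
        (hψ.comp contDiff_snd).log fun p => (hψpos p.2).ne'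
      unfold Function.uncurry
      fun_prop
    · intro k
      fin_cases k
      · refine ⟨hR.mono Icc_subset_Ici_self, ?_⟩
        have := ((hr T hT).absolutelyContinuousOnInterval_intervalIntegral
          left_mem_uIcc).boundedVariationOn
        rwa [uIcc_of_le hT.le] at this
      · refine ⟨hQL.1.mono Icc_subset_Ici_self, ?_⟩
        have hmono : MonotoneOn QL (Set.Icc 0 T) := hQL.monotoneOn.mono Icc_subset_Ici_self
        refine hmono.boundedVariationOn (C := |QL T|) fun x hx => ?_
        have h1 := hmono ⟨le_rfl, hT.le⟩ hx hx.1
        have h2 := hmono hx ⟨hT.le, le_rfl⟩ hx.2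
        rw [hQL.2.1] at h1
        exact abs_le_abs_of_nonneg h1 h2
    · intro t ht
      have hSt : 0 < S t := hSpos t ht.1
      have e : Real.exp (m * Real.log (S t) + (1 - m) * (∫ s in (0 : ℝ)..t, r s)
          - m * (m - 1) / 2 * QL t) = Real.exp ((m - 1) * Real.log (S t) +
          (1 - m) * (∫ s in (0 : ℝ)..t, r s) - m * (m - 1) / 2 * QL t) * S t := by
        nth_rewrite 3 [← Real.exp_log hSt]
        rw [← Real.exp_add]
        congr 1
        ring
      simp only [hψid _ (hmin ht), Matrix.cons_val_zero, Matrix.cons_val_one]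
      rw [hξ, hCexp t ht.1, e]
      field_simp
  · intro t _
    rw [hη, div_mul_cancel₀ _ (hBpos t).ne']
    ring
  · intro t ht
    have hito := convTo_ito_exp hr hX hQL hm.le hCexp ht
    have hBito := convTo_ito_exp hr hX hQL le_rfl (C := B) (c := 1) (fun s _ => by simp [hB]) ht
    refine ⟨_, hito.congr ht fun u v hu huv _ => ?_, ?_⟩
    · have hSu : 0 < S u := hSpos u hu
      rw [hξ, Real.exp_sub, Real.exp_log hSu, Real.exp_log (hSpos v (hu.trans huv))]
      field_simp
    · have hBeq : B t - B 0 = ∫ s in (0 : ℝ)..t, B s * r s := by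
        have h0 : ConvTo G (fun u v => 0 * B u *
            (Real.exp (Real.log (S v) - Real.log (S u)) - 1)) t 0 := by
          simp [ConvTo, gridSum]
        have := tendsto_nhds_unique hBito h0
        linarith
      have hBc : ContinuousOn B (Set.Ici 0) := by
        rw [funext hB]
        fun_prop
      have hCc : ContinuousOn C (Set.Ici 0) := by
        have hQc := hQL.1
        exact ContinuousOn.congr (by fun_prop) fun s hs => hCexp s hs
      have hri := intervalIntegrable_of_nonneg hr le_rfl ht
      have hsub : uIcc 0 t ⊆ Set.Ici 0 := by
        rw [uIcc_of_le ht]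
        exact Icc_subset_Ici_self
      have hint : (∫ s in (0 : ℝ)..t, η s * r s * B s) =
          (1 - m) * (∫ s in (0 : ℝ)..t, C s * r s) + α * V₀ * ∫ s in (0 : ℝ)..t, B s * r s := by
        rw [← intervalIntegral.integral_const_mul, ← intervalIntegral.integral_const_mul,
          ← intervalIntegral.integral_add
            ((hri.continuousOn_mul (hCc.mono hsub)).const_mul _)
            ((hri.continuousOn_mul (hBc.mono hsub)).const_mul _)]
        refine intervalIntegral.integral_congr fun s hs => ?_
        have hSs : 0 < S s := hSpos s (hsub hs)
        have hBs := hBpos s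
        simp only [hη, hV, hξ]
        field_simp
        ring
      have hB0 : B 0 = 1 := by simp [hB]
      have hCz : C 0 = (1 - α) * V₀ := by simp [hC, hB0, hQL.2.1, hS0.ne']
      rw [hint, ← hBeq, hV, hB0, hCz]
      ring
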